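/- arXiv:1212.5637 — 2 statements merged into one kernel-verified Lean document; each statement's English description precedes it below -/
import Mathlib

section
/- On any labeled weighted tree (T,y) with n nodes, the tree linearization step of WTA generates a line graph L such that: (1) Φ^W_L(y) ≤ min over all labelings y'∈{−1,+1}^n of 2·(Φ^W_T(y') + ζ_T(δ(y,y'))); and (2) Φ_L(y) ≤ min over all labelings y'∈{−1,+1}^n of 2·(Φ_T(y') + δ(y,y')). -/
open Classical

noncomputable section

variable {V : Type} [Fintype V] [DecidableEq V]

/-- The predicate on unordered edges saying the two endpoints have different labels
(a φ-edge). -/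
def phiPred (y : V → Bool) : Sym2 V → Prop :=
  Sym2.lift ⟨fun i j => y i ≠ y j, fun _ _ => propext ne_comm⟩

/-- The set of φ-edges of a labeled graph. -/
def phiEdges (G : SimpleGraph V) (y : V → Bool) : Set (Sym2 V) :=
  {e ∈ G.edgeSet | phiPred y e}

/-- The cutsize `Φ_G(y)`: number of φ-edges. -/
def cutN (G : SimpleGraph V) (y : V → Bool) : ℕ := (phiEdges G y).ncard

/-- The weighted cutsize `Φ^W_G(y)`. -/
def cutW (G : SimpleGraph V) (w : Sym2 V → ℝ) (y : V → Bool) : ℝ :=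
  ∑ᶠ e ∈ phiEdges G y, w e

/-- The weight of a spanning tree: product of its edge weights. -/
def treeWeight (w : Sym2 V → ℝ) (T : SimpleGraph V) : ℝ :=
  ∏ᶠ e ∈ T.edgeSet, w e

/-- `T` is a spanning tree of `G`. -/
def IsSpanningTree (G T : SimpleGraph V) : Prop := T ≤ G ∧ T.IsTree

/-- Expectation, over a random spanning tree of `G` drawn with probability proportional to
the product of its edge weights, of a function `f` of the tree. -/
def rstExp (G : SimpleGraph V) (w : Sym2 V → ℝ) (f : SimpleGraph V → ℝ) : ℝ :=
  (∑ᶠ T ∈ {T : SimpleGraph V | IsSpanningTree G T}, treeWeight w T * f T) /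
    ∑ᶠ T ∈ {T : SimpleGraph V | IsSpanningTree G T}, treeWeight w T

/-- `R^W_T(¬E')`: sum of resistors of φ-free edges outside `E'`. -/
def resistorSum (T : SimpleGraph V) (w : Sym2 V → ℝ) (y : V → Bool) (E' : Set (Sym2 V)) : ℝ :=
  ∑ᶠ e ∈ T.edgeSet \ (phiEdges T y ∪ E'), 1 / w e

/-- Effective conductance between `i` and `j` (Dirichlet principle). -/
def effCond (w : Sym2 V → ℝ) (i j : V) : ℝ :=
  sInf {x | ∃ φ : V → ℝ, φ i = 1 ∧ φ j = 0 ∧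
    x = (1 / 2) * ∑ u : V, ∑ v : V, w s(u, v) * (φ u - φ v) ^ 2}

/-- Effective resistance between `i` and `j`. -/
def effRes (w : Sym2 V → ℝ) (i j : V) : ℝ := 1 / effCond w i j

/-- Resistance distance between nodes `i` and `j` of a weighted line graph whose `k`-th edge
joins nodes `k` and `k+1` and has weight `wl k`. -/
def lineDist (wl : ℕ → ℝ) (i j : ℕ) : ℝ :=
  ∑ k ∈ Finset.Ico (min i j) (max i j), 1 / wl k

/-- φ-edges of a weighted line graph with `n` nodes `0, …, n-1`. -/
def linePhiSet (n : ℕ) (yl : ℕ → Bool) : Finset ℕ :=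
  (Finset.range (n - 1)).filter (fun k => yl k ≠ yl (k + 1))

/-- Cutsize of a labeled line graph. -/
def linePhi (n : ℕ) (yl : ℕ → Bool) : ℕ := (linePhiSet n yl).card

/-- Weighted cutsize of a labeled weighted line graph. -/
def linePhiW (n : ℕ) (wl : ℕ → ℝ) (yl : ℕ → Bool) : ℝ :=
  ∑ k ∈ linePhiSet n yl, wl k

/-- A run of the nearest-neighbor rule (the prediction phase of WTA) on a weighted line
graph with `n` nodes, weights `wl` and labels `yl`: an adversarial presentation order `σ`
together with predictions `pred`, where each prediction (after the first) is the label of a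
closest previously revealed node in resistance distance. -/
structure NNRun (n : ℕ) (wl : ℕ → ℝ) (yl : ℕ → Bool) where
  σ : Fin n → Fin n
  bij : Function.Bijective σ
  pred : Fin n → Bool
  nn : ∀ t : Fin n, 0 < (t : ℕ) →
    ∃ s : Fin n, (s : ℕ) < (t : ℕ) ∧
      (∀ s' : Fin n, (s' : ℕ) < (t : ℕ) →
        lineDist wl (σ s : ℕ) (σ t : ℕ) ≤ lineDist wl (σ s' : ℕ) (σ t : ℕ)) ∧
      pred t = yl (σ s : ℕ)

/-- Number of prediction mistakes of a nearest-neighbor run. -/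
def NNRun.mistakes {n : ℕ} {wl : ℕ → ℝ} {yl : ℕ → Bool} (r : NNRun n wl yl) : ℕ :=
  (Finset.univ.filter (fun t : Fin n => r.pred t ≠ yl (r.σ t : ℕ))).card

/-- Position of the first occurrence of `v` in the walk. -/
def firstOcc (walk : ℕ → V) (v : V) : ℕ := sInf {t | walk t = v}

/-- WTA's linearization of a tree `T` with `n` nodes: a depth-first visit of `T` is a closed
walk traversing each edge of `T` exactly twice; it produces the line graph with duplicates
`L'` (nodes `walk 0, …, walk (2(n-1))`, the `t`-th edge having weight `w s(walk t, walk (t+1))`).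
Duplicate elimination yields the line graph `L` whose nodes are the nodes of `T` in order of
first visit (`ord`), consecutive nodes being joined by an edge whose weight is the minimum
weight among the eliminated edges of `L'` between them. -/
structure Linearization (T : SimpleGraph V) (n : ℕ) where
  walk : ℕ → V
  adj : ∀ t < 2 * (n - 1), T.Adj (walk t) (walk (t + 1))
  closed : walk (2 * (n - 1)) = walk 0
  twice : ∀ e ∈ T.edgeSet,
    ((Finset.range (2 * (n - 1))).filter (fun t => s(walk t, walk (t + 1)) = e)).card = 2
  ord : ℕ → V
  ord_inj : ∀ k < n, ∀ k' < n, ord k = ord k' → k = k'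
  ord_surj : ∀ v : V, ∃ k < n, ord k = v
  ord_mono : ∀ k k', k < k' → k' < n → firstOcc walk (ord k) < firstOcc walk (ord k')

/-- Edge weights of the line graph `L` produced by the linearization: the `k`-th edge of `L`
joins the `k`-th and `(k+1)`-th nodes in order of first visit, and its weight is the minimum
of the weights of the edges of `L'` lying between the first occurrences of these two nodes
(the iterated duplicate-elimination rule `w_{j',j''} = min {w_{j',j}, w_{j,j''}}`). -/
def Linearization.wl {T : SimpleGraph V} {n : ℕ} (L : Linearization T n)
    (w : Sym2 V → ℝ) (k : ℕ) : ℝ :=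
  sInf ((fun t => w s(L.walk t, L.walk (t + 1))) ''
    Set.Ico (firstOcc L.walk (L.ord k)) (firstOcc L.walk (L.ord (k + 1))))

/-- Labels of the line graph `L`: each node of `L` inherits the label of the corresponding
node of `T`. -/
def Linearization.yl {T : SimpleGraph V} {n : ℕ} (L : Linearization T n)
    (y : V → Bool) (k : ℕ) : Bool := y (L.ord k)

/-- `ζ_T(K)`: the total weight of the `K` heaviest edges of `T`. -/
def zeta (T : SimpleGraph V) (w : Sym2 V → ℝ) (K : ℕ) : ℝ :=
  sSup {x | ∃ E' ⊆ T.edgeSet, E'.ncard = K ∧ x = ∑ᶠ e ∈ E', w e}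

/-- `δ(y,y')`: number of nodes where the two labelings differ. -/
def hamming (y y' : V → Bool) : ℕ := {i | y i ≠ y' i}.ncard


/-- `Φ̃^W_T(y)`: robust weighted cutsize (minimum over perturbed labelings). -/
def robustCutW (T : SimpleGraph V) (w : Sym2 V → ℝ) (y : V → Bool) : ℝ :=
  sInf {x | ∃ y' : V → Bool, x = 2 * (cutW T w y' + zeta T w (hamming y y'))}

/-- `Φ̃_T(y)`: robust cutsize (minimum over perturbed labelings). -/
def robustCutN (T : SimpleGraph V) (y : V → Bool) : ℝ :=
  sInf {x | ∃ y' : V → Bool, x = 2 * ((cutN T y' : ℝ) + (hamming y y' : ℝ))}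

/-- `Φ*_G(y)`: robust expected cutsize of a random spanning tree of `G`. -/
def robustCutRST (G : SimpleGraph V) (w : Sym2 V → ℝ) (y : V → Bool) : ℝ :=
  sInf {x | ∃ y' : V → Bool,
    x = rstExp G w (fun T => (cutN T y' : ℝ)) + (hamming y y' : ℝ)}

/-- Cutsize of the line graph with duplicates `L'`. -/
def Linearization.phi' {T : SimpleGraph V} {n : ℕ} (L : Linearization T n)
    (y : V → Bool) : ℕ :=
  ((Finset.range (2 * (n - 1))).filter (fun t => y (L.walk t) ≠ y (L.walk (t + 1)))).card

/-- Weighted cutsize of the line graph with duplicates `L'`. -/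
def Linearization.phiW' {T : SimpleGraph V} {n : ℕ} (L : Linearization T n)
    (w : Sym2 V → ℝ) (y : V → Bool) : ℝ :=
  ∑ t ∈ (Finset.range (2 * (n - 1))).filter (fun t => y (L.walk t) ≠ y (L.walk (t + 1))),
    w s(L.walk t, L.walk (t + 1))

/-- `p_e`: the probability that edge `e` belongs to a random spanning tree of `G`. -/
def edgeProb (G : SimpleGraph V) (w : Sym2 V → ℝ) (e : Sym2 V) : ℝ :=
  rstExp G w (fun T => if e ∈ T.edgeSet then 1 else 0)

/-- `p_{i,j} = w_{i,j} · r^W_{i,j}`. -/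
def pWeight (w : Sym2 V → ℝ) (i j : V) : ℝ := w s(i, j) * effRes w i j

/-- `P_i = Σ_j p_{i,j}`: the weight of node `i`. -/
def nodeWeight (G : SimpleGraph V) (w : Sym2 V → ℝ) (i : V) : ℝ :=
  ∑ j : V, if G.Adj i j then pWeight w i j else 0

/-- The `p`-weighted cutsize `Φ^P_G(y)`. -/
def pCutW (G : SimpleGraph V) (w : Sym2 V → ℝ) (y : V → Bool) : ℝ :=
  (1 / 2) * ∑ u : V, ∑ v : V, if G.Adj u v ∧ y u ≠ y v then pWeight w u v else 0

/-- `P^int_S`: sum of `p_{i,j}` over edges with both endpoints in `S`. -/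
def pIntS (G : SimpleGraph V) (w : Sym2 V → ℝ) (S : Finset V) : ℝ :=
  (1 / 2) * ∑ i ∈ S, ∑ j ∈ S, if G.Adj i j then pWeight w i j else 0

/-- `P^ext_S`: sum of `p_{i,j}` over edges with exactly one endpoint in `S`. -/
def pExtS (G : SimpleGraph V) (w : Sym2 V → ℝ) (S : Finset V) : ℝ :=
  ∑ i ∈ S, ∑ j ∈ Sᶜ, if G.Adj i j then pWeight w i j else 0

end

/-- A sum along distinct edges of `T`, at most `K` of them, is bounded by the total weight of the
`K` heaviest edges. -/
lemma sum_le_zeta {V ι : Type} [Fintype V] [DecidableEq V] {T : SimpleGraph V} {w : Sym2 V → ℝ}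
    (hw : ∀ e ∈ T.edgeSet, 0 < w e) {K : ℕ} (hK : K ≤ T.edgeSet.ncard) (s : Finset ι)
    (hs : s.card ≤ K) (g : ι → Sym2 V) (hg : Set.InjOn g s) (hgT : ∀ i ∈ s, g i ∈ T.edgeSet) :
    ∑ i ∈ s, w (g i) ≤ zeta T w K := by
  have hsub : (s.image g : Set (Sym2 V)) ⊆ T.edgeSet := by
    intro e he
    obtain ⟨i, hi, rfl⟩ := Finset.mem_image.1 (Finset.mem_coe.1 he)
    exact hgT i hi
  have hcard : (s.image g : Set (Sym2 V)).ncard ≤ K := by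
    rw [Set.ncard_coe_finset]
    exact Finset.card_image_le.trans hs
  obtain ⟨E, hE₁, hE₂, hE₃⟩ := Set.exists_subsuperset_card_eq hsub hcard hK
  have hfin : {x | ∃ E' ⊆ T.edgeSet, E'.ncard = K ∧ x = ∑ᶠ e ∈ E', w e}.Finite := by
    refine (Set.finite_range fun E' : Set (Sym2 V) => ∑ᶠ e ∈ E', w e).subset ?_
    rintro x ⟨E', -, -, rfl⟩
    exact ⟨E', rfl⟩
  refine le_trans ?_ (le_csSup hfin.bddAbove ⟨E, hE₂, hE₃, rfl⟩)
  rw [← Finset.sum_image hg, finsum_mem_eq_toFinset_sum]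
  refine Finset.sum_le_sum_of_subset_of_nonneg ?_ ?_
  · intro e he
    exact Set.mem_toFinset.2 (hE₁ he)
  · intro e he _
    exact (hw e (hE₂ (Set.mem_toFinset.1 he))).le

lemma zeta_nonneg {V : Type} {T : SimpleGraph V} {w : Sym2 V → ℝ}
    (hw : ∀ e ∈ T.edgeSet, 0 < w e) (K : ℕ) : 0 ≤ zeta T w K := by
  refine Real.sSup_nonneg ?_
  rintro x ⟨E, hE, -, rfl⟩
  exact finsum_mem_induction (0 ≤ ·) le_rfl (fun _ _ => add_nonneg) fun e he => (hw e (hE he)).le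

lemma cutW_nonneg {V : Type} {T : SimpleGraph V} {w : Sym2 V → ℝ}
    (hw : ∀ e ∈ T.edgeSet, 0 < w e) (y : V → Bool) : 0 ≤ cutW T w y :=
  finsum_mem_induction (0 ≤ ·) le_rfl (fun _ _ => add_nonneg) fun e he => (hw e he.1).le

lemma finsum_mem_const_one {α : Type} [Finite α] (s : Set α) :
    ∑ᶠ _ ∈ s, (1 : ℝ) = s.ncard := by
  rw [finsum_mem_eq_finite_toFinset_sum _ s.toFinite, Set.ncard_eq_toFinset_card s s.toFinite]
  simp

lemma zeta_one_le {V : Type} [Finite V] (T : SimpleGraph V) (K : ℕ) : zeta T (fun _ => 1) K ≤ K := by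
  refine Real.sSup_le ?_ K.cast_nonneg
  rintro x ⟨E, -, rfl, rfl⟩
  rw [finsum_mem_const_one]

lemma cutW_one {V : Type} [Finite V] (T : SimpleGraph V) (y : V → Bool) :
    cutW T (fun _ => 1) y = cutN T y := by
  rw [cutW, cutN, finsum_mem_const_one]

lemma exists_step_ne (a : ℕ → Bool) {s t : ℕ} (hst : s ≤ t) (h : a s ≠ a t) :
    ∃ r, s ≤ r ∧ r < t ∧ a r ≠ a (r + 1) := by
  induction t, hst using Nat.le_induction with
  | base => exact absurd rfl h
  | succ t hst ih =>
    by_cases hat : a s = a t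
    · exact ⟨t, hst, t.lt_succ_self, hat ▸ h⟩
    · obtain ⟨r, h₁, h₂, h₃⟩ := ih hat
      exact ⟨r, h₁, h₂.trans t.lt_succ_self, h₃⟩

namespace Linearization

variable {V : Type} [DecidableEq V] {T : SimpleGraph V} {n : ℕ} (L : Linearization T n)

/-- The `t`-th edge of the walk. -/
abbrev edge (t : ℕ) : Sym2 V := s(L.walk t, L.walk (t + 1))

/-- The time at which the `k`-th node is first visited. -/
noncomputable abbrev time (k : ℕ) : ℕ := firstOcc L.walk (L.ord k)

lemma firstOcc_le {v : V} {t : ℕ} (h : L.walk t = v) : firstOcc L.walk v ≤ t :=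
  Nat.sInf_le h

lemma time_lt_time_succ {k : ℕ} (hk : k < n - 1) : L.time k < L.time (k + 1) :=
  L.ord_mono k (k + 1) k.lt_succ_self (by omega)

lemma time_le_time {j k : ℕ} (hjk : j ≤ k) (hk : k < n) : L.time j ≤ L.time k := by
  obtain rfl | h := hjk.eq_or_lt
  · exact le_rfl
  · exact (L.ord_mono j k h hk).le

lemma eq_of_mem_Ico {j k t : ℕ} (hj : j < n - 1) (hk : k < n - 1) (h₁ : L.time j ≤ t)
    (h₂ : t < L.time (j + 1)) (h₃ : L.time k ≤ t) (h₄ : t < L.time (k + 1)) : j = k := by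
  rcases lt_trichotomy j k with h | h | h
  · have := L.time_le_time (Nat.add_one_le_iff.2 h) (by omega); omega
  · exact h
  · have := L.time_le_time (Nat.add_one_le_iff.2 h) (by omega); omega

lemma wl_one {k : ℕ} (hk : k < n - 1) : L.wl (fun _ => 1) k = 1 := by
  rw [wl, Set.Nonempty.image_const ⟨_, Set.left_mem_Ico.2 (L.time_lt_time_succ hk)⟩, csInf_singleton]

lemma linePhiW_one (y : ℕ → Bool) : linePhiW n (L.wl fun _ => 1) y = linePhi n y := by
  rw [linePhiW, Finset.sum_congr (s₁ := linePhiSet n y) rfl fun k hk =>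
    L.wl_one (Finset.mem_range.1 (Finset.mem_filter.1 hk).1)]
  simp [linePhi]

variable [Fintype V]

lemma exists_walk_eq (hT : T.IsTree) (hn : n = Fintype.card V) (h2 : 2 ≤ n) (v : V) :
    ∃ t ≤ 2 * (n - 1), L.walk t = v := by
  classical
  have : Nontrivial V := Fintype.one_lt_card_iff_nontrivial.1 (by omega)
  obtain ⟨u, hu⟩ := hT.connected.preconnected.exists_adj_of_nontrivial v
  have hc := L.twice s(v, u) hu
  have hne : ((Finset.range (2 * (n - 1))).filter (fun t => L.edge t = s(v, u))).Nonempty :=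
    Finset.card_pos.1 (hc.symm ▸ Nat.two_pos)
  obtain ⟨t, ht⟩ := hne
  rw [Finset.mem_filter, Finset.mem_range, Sym2.eq_iff] at ht
  obtain ⟨ht, h | h⟩ := ht
  · exact ⟨t, ht.le, h.1⟩
  · exact ⟨t + 1, ht, h.2⟩

lemma walk_firstOcc (hT : T.IsTree) (hn : n = Fintype.card V) (h2 : 2 ≤ n) (v : V) :
    L.walk (firstOcc L.walk v) = v := by
  obtain ⟨t, -, ht⟩ := L.exists_walk_eq hT hn h2 v
  exact Nat.sInf_mem (s := {t | L.walk t = v}) ⟨t, ht⟩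

lemma time_le (hT : T.IsTree) (hn : n = Fintype.card V) (h2 : 2 ≤ n) (k : ℕ) :
    L.time k ≤ 2 * (n - 1) := by
  obtain ⟨t, ht, h⟩ := L.exists_walk_eq hT hn h2 (L.ord k)
  exact (L.firstOcc_le h).trans ht

section Weight

variable {w : Sym2 V → ℝ}

lemma wl_le (hT : T.IsTree) (hn : n = Fintype.card V) (h2 : 2 ≤ n)
    (hw : ∀ e ∈ T.edgeSet, 0 < w e) {k t : ℕ} (h₁ : L.time k ≤ t) (h₂ : t < L.time (k + 1)) :
    L.wl w k ≤ w (L.edge t) := by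
  refine csInf_le ⟨0, ?_⟩ ⟨t, ⟨h₁, h₂⟩, rfl⟩
  rintro x ⟨r, hr, rfl⟩
  exact (hw _ (L.adj r (hr.2.trans_le (L.time_le hT hn h2 _)))).le

lemma wl_nonneg (hT : T.IsTree) (hn : n = Fintype.card V) (h2 : 2 ≤ n)
    (hw : ∀ e ∈ T.edgeSet, 0 < w e) (k : ℕ) : 0 ≤ L.wl w k := by
  refine Real.sInf_nonneg ?_
  rintro x ⟨r, hr, rfl⟩
  exact (hw _ (L.adj r (hr.2.trans_le (L.time_le hT hn h2 _)))).le

lemma phiW'_eq (w : Sym2 V → ℝ) (y : V → Bool) :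
    L.phiW' w y = 2 * cutW T w y := by
  classical
  rw [cutW, finsum_mem_eq_toFinset_sum, Finset.mul_sum, phiW']
  rw [← Finset.sum_fiberwise_of_maps_to (g := L.edge) (t := (phiEdges T y).toFinset)]
  · refine Finset.sum_congr rfl fun e he => ?_
    rw [Set.mem_toFinset] at he
    have hc := L.twice e he.1
    rw [Finset.filter_filter, Finset.sum_congr rfl (g := fun _ => w e), Finset.sum_const,
      nsmul_eq_mul]
    · congr 1
      refine (congrArg Nat.cast
        ((congrArg Finset.card (Finset.ext fun t => ?_)).trans hc)).trans Nat.cast_two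
      simp only [Finset.mem_filter, and_congr_right_iff]
      refine fun _ => ⟨fun h => h.2, fun h => ⟨?_, h⟩⟩
      have := he.2
      rw [← h] at this
      exact this
    · intro t ht
      rw [Finset.mem_filter] at ht
      exact congrArg w ht.2.2
  · intro t ht
    rw [Finset.mem_filter, Finset.mem_range] at ht
    exact Set.mem_toFinset.2 ⟨L.adj t ht.1, ht.2⟩

lemma linePhiW_le_two_mul_cutW (hT : T.IsTree) (hn : n = Fintype.card V) (h2 : 2 ≤ n)
    (hw : ∀ e ∈ T.edgeSet, 0 < w e) (y : V → Bool) :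
    linePhiW n (L.wl w) (L.yl y) ≤ 2 * cutW T w y := by
  classical
  have hstep : ∀ k ∈ linePhiSet n (L.yl y), ∃ t, L.time k ≤ t ∧ t < L.time (k + 1) ∧
      y (L.walk t) ≠ y (L.walk (t + 1)) := by
    intro k hk
    rw [linePhiSet, Finset.mem_filter, Finset.mem_range] at hk
    refine exists_step_ne (fun t => y (L.walk t)) (L.time_lt_time_succ hk.1).le ?_
    simpa only [L.walk_firstOcc hT hn h2, yl] using hk.2
  choose! t ht₁ ht₂ ht₃ using hstep
  have hlt : ∀ k ∈ linePhiSet n (L.yl y), k < n - 1 := fun k hk =>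
    Finset.mem_range.1 (Finset.mem_filter.1 hk).1
  have hinj : Set.InjOn t (linePhiSet n (L.yl y)) := fun j hj k hk h =>
    L.eq_of_mem_Ico (hlt j hj) (hlt k hk) (ht₁ j hj) (ht₂ j hj) (h ▸ ht₁ k hk) (h ▸ ht₂ k hk)
  rw [← L.phiW'_eq, phiW', linePhiW]
  calc ∑ k ∈ linePhiSet n (L.yl y), L.wl w k
      ≤ ∑ k ∈ linePhiSet n (L.yl y), w (L.edge (t k)) :=
        Finset.sum_le_sum fun k hk => L.wl_le hT hn h2 hw (ht₁ k hk) (ht₂ k hk)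
    _ = ∑ r ∈ (linePhiSet n (L.yl y)).image t, w (L.edge r) :=
        (Finset.sum_image (f := fun r => w (L.edge r)) hinj).symm
    _ ≤ _ := by
        refine Finset.sum_le_sum_of_subset_of_nonneg ?_ ?_
        · intro r hr
          obtain ⟨k, hk, rfl⟩ := Finset.mem_image.1 hr
          exact Finset.mem_filter.2
            ⟨Finset.mem_range.2 ((ht₂ k hk).trans_le (L.time_le hT hn h2 _)), ht₃ k hk⟩
        · intro r hr _
          exact (hw _ (L.adj r (Finset.mem_range.1 (Finset.mem_filter.1 hr).1))).le

/-- The edges through which the nodes of the tree are first reached are distinct. -/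
lemma edge_time_succ_injOn (hT : T.IsTree) (hn : n = Fintype.card V) (h2 : 2 ≤ n) :
    Set.InjOn (fun k => L.edge (L.time (k + 1) - 1)) {k | k < n - 1} := by
  intro j hj k hk h
  have hj' := L.time_lt_time_succ hj
  have hk' := L.time_lt_time_succ hk
  simp only [edge, Nat.sub_add_cancel (by omega : 1 ≤ L.time (j + 1)),
    Nat.sub_add_cancel (by omega : 1 ≤ L.time (k + 1)), L.walk_firstOcc hT hn h2,
    Sym2.eq_iff] at h
  rcases h with h | h
  · have := L.ord_inj (j + 1) (by simp at hj; omega) (k + 1) (by simp at hk; omega) h.2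
    omega
  · have h₁ := L.firstOcc_le h.1
    have h₂ := L.firstOcc_le h.2.symm
    dsimp only [time] at *
    omega

/-- The edges of the line graph selected by `s` weigh at most as much as the `K` heaviest edges
of the tree. -/
lemma sum_wl_le_zeta (hT : T.IsTree) (hn : n = Fintype.card V) (h2 : 2 ≤ n)
    (hw : ∀ e ∈ T.edgeSet, 0 < w e) {K : ℕ} (hK : K ≤ n - 1) {s : Finset ℕ}
    (hs : ∀ k ∈ s, k < n - 1) (hsK : s.card ≤ K) :
    ∑ k ∈ s, L.wl w k ≤ zeta T w K := by
  have hcard : T.edgeSet.ncard = n - 1 := by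
    have h := (SimpleGraph.isTree_iff_connected_and_card.1 hT).2
    rw [Nat.card_coe_set_eq, Nat.card_eq_fintype_card] at h
    omega
  have hpos : ∀ k ∈ s, L.time k ≤ L.time (k + 1) - 1 ∧ L.time (k + 1) - 1 < L.time (k + 1) := by
    intro k hk
    have := L.time_lt_time_succ (hs k hk)
    omega
  calc ∑ k ∈ s, L.wl w k ≤ ∑ k ∈ s, w (L.edge (L.time (k + 1) - 1)) :=
        Finset.sum_le_sum fun k hk => L.wl_le hT hn h2 hw (hpos k hk).1 (hpos k hk).2
    _ ≤ zeta T w K := by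
        refine sum_le_zeta hw (hcard ▸ hK) s hsK _
          ((L.edge_time_succ_injOn hT hn h2).mono hs) fun k hk => ?_
        exact L.adj _ ((hpos k hk).2.trans_le (L.time_le hT hn h2 _))

lemma linePhiW_le (hT : T.IsTree) (hn : n = Fintype.card V) (hw : ∀ e ∈ T.edgeSet, 0 < w e)
    (y y' : V → Bool) :
    linePhiW n (L.wl w) (L.yl y) ≤ 2 * (cutW T w y' + zeta T w (hamming y y')) := by
  classical
  have hζ := zeta_nonneg hw (hamming y y')
  obtain h2 | h2 : n < 2 ∨ 2 ≤ n := by omega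
  · have h0 : n - 1 = 0 := by omega
    have := cutW_nonneg hw y'
    simp only [linePhiW, linePhiSet, h0, Finset.range_zero, Finset.filter_empty, Finset.sum_empty]
    positivity
  have hcut := L.linePhiW_le_two_mul_cutW hT hn h2 hw y'
  obtain hK | hK := le_or_gt (hamming y y') (n - 1)
  · set s := (Finset.range (n - 1)).filter fun k => y (L.ord k) ≠ y' (L.ord k) with hs
    set s' := (Finset.range (n - 1)).filter fun k => y (L.ord (k + 1)) ≠ y' (L.ord (k + 1))
      with hs'
    have hsub : linePhiSet n (L.yl y) ⊆ linePhiSet n (L.yl y') ∪ (s ∪ s') := by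
      intro k
      simp only [linePhiSet, yl, hs, hs', Finset.mem_union, Finset.mem_filter]
      grind
    have hcard : s.card ≤ hamming y y' := by
      rw [← Set.ncard_coe_finset]
      refine Set.ncard_le_ncard_of_injOn L.ord (fun k hk => (Finset.mem_filter.1 hk).2) ?_
      intro j hj k hk h
      simp only [hs, Finset.coe_filter, Finset.mem_range, Set.mem_ofPred_eq] at hj hk
      exact L.ord_inj j (by omega) k (by omega) h
    have hcard' : s'.card ≤ hamming y y' := by
      rw [← Set.ncard_coe_finset]
      refine Set.ncard_le_ncard_of_injOn (fun k => L.ord (k + 1))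
        (fun k hk => (Finset.mem_filter.1 hk).2) ?_
      intro j hj k hk h
      simp only [hs', Finset.coe_filter, Finset.mem_range, Set.mem_ofPred_eq] at hj hk
      have := L.ord_inj (j + 1) (by omega) (k + 1) (by omega) h
      omega
    have hsum := L.sum_wl_le_zeta hT hn h2 hw hK
      (fun k hk => Finset.mem_range.1 (Finset.mem_filter.1 hk).1) hcard
    have hsum' := L.sum_wl_le_zeta hT hn h2 hw hK
      (fun k hk => Finset.mem_range.1 (Finset.mem_filter.1 hk).1) hcard'
    have hnn := L.wl_nonneg hT hn h2 hw
    have hunion : ∀ a b : Finset ℕ,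
        ∑ k ∈ a ∪ b, L.wl w k ≤ ∑ k ∈ a, L.wl w k + ∑ k ∈ b, L.wl w k := by
      intro a b
      rw [← Finset.sum_union_inter]
      exact le_add_of_nonneg_right (Finset.sum_nonneg fun k _ => hnn k)
    have h₁ := Finset.sum_le_sum_of_subset_of_nonneg hsub fun k _ _ => hnn k
    have h₂ := hunion (linePhiSet n (L.yl y')) (s ∪ s')
    have h₃ := hunion s s'
    rw [linePhiW] at hcut ⊢
    linarith
  · have huniv : {i | y i ≠ y' i} = Set.univ := by
      refine Set.eq_of_subset_of_ncard_le (Set.subset_univ _) ?_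
      rw [Set.ncard_univ, Nat.card_eq_fintype_card]
      change Fintype.card V ≤ hamming y y'
      omega
    have hne : ∀ i, y i ≠ y' i := fun i => huniv.symm.subset (Set.mem_univ i)
    have hset : linePhiSet n (L.yl y) = linePhiSet n (L.yl y') := by
      refine Finset.filter_congr fun k _ => ?_
      simp [yl, fun i => Bool.eq_not.2 (hne i)]
    rw [linePhiW, hset]
    rw [linePhiW] at hcut
    linarith

end Weight

end Linearization

/-- Theorem 4. On any labeled weighted tree `(T,y)` with `n` nodes, the
tree linearization step of WTA generates a line graph `L` such that, for every labeling
`y'`: (1) `Φ^W_L(y) ≤ 2(Φ^W_T(y') + ζ_T(δ(y,y')))` and (2) `Φ_L(y) ≤ 2(Φ_T(y') + δ(y,y'))`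
(equivalently, the bounds hold with the minimum over all labelings `y'`). -/
theorem wta_linearization_robust :
    ∀ (V : Type) [Fintype V] [DecidableEq V] (T : SimpleGraph V),
      T.IsTree →
      ∀ w : Sym2 V → ℝ, (∀ e ∈ T.edgeSet, 0 < w e) →
      ∀ (y : V → Bool) (n : ℕ), n = Fintype.card V →
      ∀ L : Linearization T n,
        (∀ y' : V → Bool,
          linePhiW n (L.wl w) (L.yl y) ≤ 2 * (cutW T w y' + zeta T w (hamming y y'))) ∧
        (∀ y' : V → Bool,
          (linePhi n (L.yl y) : ℝ) ≤ 2 * ((cutN T y' : ℝ) + (hamming y y' : ℝ))) := by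
  intro V _ _ T hT w hw y n hn L
  refine ⟨L.linePhiW_le hT hn hw y, fun y' => ?_⟩
  have h := L.linePhiW_le hT hn (w := fun _ => 1) (fun _ _ => one_pos) y y'
  rw [L.linePhiW_one, cutW_one] at h
  linarith [zeta_one_le T (hamming y y')]
end

section
/- Let T be a tree with edge set E(T), and let L' and L be the line graphs obtained from T by WTA's tree linearization (L' the line with duplicates produced by the depth-first visit, L the line after duplicate elimination). Then: (1) there exists a partition P_{L'} of the edge set of L' into pairs and a bijection μ_{L'}: P_{L'} → E(T) such that the weight of both edges in each pair S' ∈ P_{L'} equals the weight of the edge μ_{L'}(S'); and (2) there exists a partition P_L of the edge set of L into sets S with |S| ≤ 2 and an injective map μ_L : P_L → E(T) such that the weight of every edge in each set S ∈ P_L equals the weight of the edge μ_L(S). -/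
open Classical

/-- In a linearization of a tree with at least two nodes, every node is first visited during the
closed walk. -/
theorem Linearization.firstOcc_le_s10 {V : Type} [Fintype V] [DecidableEq V] [Nontrivial V]
    {T : SimpleGraph V} {n : ℕ} (hT : T.Connected) (L : Linearization T n) (v : V) :
    firstOcc L.walk v ≤ 2 * (n - 1) := by
  obtain ⟨u, hu⟩ := hT.preconnected.exists_adj_of_nontrivial v
  have hcard := L.twice s(v, u) hu
  obtain ⟨t, ht⟩ := Finset.card_pos.1 (hcard ▸ Nat.zero_lt_two)
  obtain ⟨htn, hte⟩ := Finset.mem_filter.1 ht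
  rw [Finset.mem_range] at htn
  rcases Sym2.eq_iff.1 hte with ⟨h, -⟩ | ⟨-, h⟩
  · exact (Nat.sInf_le h).trans htn.le
  · exact (Nat.sInf_le h).trans htn

/-- The weight of an edge of the line graph `L` is attained by an edge of `L'` lying between the
first occurrences of its endpoints. -/
theorem Linearization.exists_wl_eq {V : Type} [Fintype V] [DecidableEq V]
    {T : SimpleGraph V} {n : ℕ} (L : Linearization T n) (w : Sym2 V → ℝ) {k : ℕ}
    (hk : k < n - 1) :
    ∃ t ∈ Set.Ico (firstOcc L.walk (L.ord k)) (firstOcc L.walk (L.ord (k + 1))),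
      w s(L.walk t, L.walk (t + 1)) = L.wl w k :=
  ((Set.nonempty_Ico.2 (L.ord_mono k (k + 1) k.lt_succ_self (by omega))).image _).csInf_mem
    ((Set.finite_Ico _ _).image _)

/-- Lemma 2. Let `T` be a tree and `L'`, `L` the line graphs obtained by
WTA's linearization (the edges of `L'` being indexed by `t < 2(n-1)`, the `t`-th edge
joining `walk t` and `walk (t+1)`; the edges of `L` being indexed by `k < n-1`).
(1) There is a map `pair` assigning to each edge of `L'` an edge of `T` of the same weight
whose fibers all have cardinality exactly `2` (i.e., a partition of `E(L')` into pairs with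
a weight-preserving bijection onto `E(T)`).
(2) There is a map `ν` assigning to each edge of `L` an edge of `T` of the same weight
whose fibers all have cardinality at most `2` (i.e., a partition of `E(L)` into sets of
size at most `2` with a weight-preserving injection into `E(T)`). -/
theorem linearization_edge_partition :
    ∀ (V : Type) [Fintype V] [DecidableEq V] (T : SimpleGraph V),
      T.IsTree →
      ∀ w : Sym2 V → ℝ, (∀ e ∈ T.edgeSet, 0 < w e) →
      ∀ n : ℕ, n = Fintype.card V →
      ∀ L : Linearization T n,
        (∃ pair : ℕ → Sym2 V,
          (∀ t < 2 * (n - 1), pair t ∈ T.edgeSet ∧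
            w s(L.walk t, L.walk (t + 1)) = w (pair t)) ∧
          (∀ e ∈ T.edgeSet,
            ((Finset.range (2 * (n - 1))).filter (fun t => pair t = e)).card = 2)) ∧
        (∃ ν : ℕ → Sym2 V,
          (∀ k < n - 1, ν k ∈ T.edgeSet ∧ L.wl w k = w (ν k)) ∧
          (∀ e ∈ T.edgeSet,
            ((Finset.range (n - 1)).filter (fun k => ν k = e)).card ≤ 2)) := by
  intro V _ _ T hT w _ n hn L
  refine ⟨⟨fun t => s(L.walk t, L.walk (t + 1)), fun t ht => ⟨L.adj t ht, rfl⟩, L.twice⟩, ?_⟩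
  have hex : ∀ k, ∃ t, k < n - 1 →
      t ∈ Set.Ico (firstOcc L.walk (L.ord k)) (firstOcc L.walk (L.ord (k + 1))) ∧
        w s(L.walk t, L.walk (t + 1)) = L.wl w k := by
    intro k
    by_cases hk : k < n - 1
    · obtain ⟨t, ht⟩ := L.exists_wl_eq w hk
      exact ⟨t, fun _ => ht⟩
    · exact ⟨0, fun h => absurd h hk⟩
  choose τ hτ using hex
  have hτ_lt : ∀ k < n - 1, τ k < 2 * (n - 1) := by
    intro k hk
    have : Nontrivial V := Fintype.one_lt_card_iff_nontrivial.1 (by omega)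
    exact (hτ k hk).1.2.trans_le (L.firstOcc_le_s10 hT.connected _)
  have hτ_strict : ∀ k k', k < k' → k' < n - 1 → τ k < τ k' := by
    intro k k' hkk' hk'
    have hle : firstOcc L.walk (L.ord (k + 1)) ≤ firstOcc L.walk (L.ord k') := by
      rcases (Nat.succ_le_of_lt hkk').eq_or_lt with h | h
      · exact (congrArg (fun i => firstOcc L.walk (L.ord i)) h).le
      · exact (L.ord_mono _ _ h (by omega)).le
    exact (hτ k (hkk'.trans hk')).1.2.trans_le (hle.trans (hτ k' hk').1.1)
  refine ⟨fun k => s(L.walk (τ k), L.walk (τ k + 1)),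
    fun k hk => ⟨L.adj _ (hτ_lt k hk), (hτ k hk).2.symm⟩, fun e he => ?_⟩
  rw [← L.twice e he]
  refine Finset.card_le_card_of_injOn τ (fun k hk => ?_) (fun k hk k' hk' h => ?_)
  · obtain ⟨hkn, hke⟩ := Finset.mem_filter.1 (Finset.mem_coe.1 hk)
    exact Finset.mem_coe.2 (Finset.mem_filter.2
      ⟨Finset.mem_range.2 (hτ_lt k (Finset.mem_range.1 hkn)), hke⟩)
  · have hkn := Finset.mem_range.1 (Finset.mem_filter.1 (Finset.mem_coe.1 hk)).1
    have hkn' := Finset.mem_range.1 (Finset.mem_filter.1 (Finset.mem_coe.1 hk')).1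
    rcases lt_trichotomy k k' with hlt | heq | hlt
    · exact absurd h (hτ_strict k k' hlt hkn').ne
    · exact heq
    · exact absurd h (hτ_strict k' k hlt hkn).ne'
end
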